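/- Let p > 0 and σ ≥ 0. For any A₁, A₂ ∈ GS_{p,σ}: (G_{p,σ}(A₁+A₂))^{p/(p+1)} ≤ (G_{p,σ}(A₁))^{p/(p+1)} + (G_{p,σ}(A₂))^{p/(p+1)} and (g_{p,σ}(A₁+A₂))^{p/(p+1)} ≤ (g_{p,σ}(A₁))^{p/(p+1)} + (G_{p,σ}(A₂))^{p/(p+1)}; the same inequalities hold with G_{p,σ}, g_{p,σ} replaced by G^{(±)}_{p,σ}, g^{(±)}_{p,σ} when A₁, A₂ are self-adjoint. -/

import Mathlib

open MeasureTheory Filter Complex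
open scoped ENNReal InnerProductSpace RealInnerProductSpace

noncomputable section

def sVal {H : Type*} [NormedAddCommGroup H] [NormedSpace ℂ H]
    (A : H →L[ℂ] H) (k : ℕ) : ℝ :=
  sInf ((fun F : H →L[ℂ] H => ‖A - F‖) ''
    {F | Module.rank ℂ (LinearMap.range (F : H →ₗ[ℂ] H)) ≤ (k : Cardinal)})

/-- `f_σ(t) = t / log^σ (t + e^{σ+1})` -/
def fSigma (σ t : ℝ) : ℝ := t / (Real.log (t + Real.exp (σ + 1))) ^ σ

variable {H : Type*} [NormedAddCommGroup H] [InnerProductSpace ℂ H]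

/-- the weighted singular value sequence `s_k(A) f_σ(k)^{1/p}` (`k = 1, 2, ...`) -/
def sWeight (p σ : ℝ) (A : H →L[ℂ] H) (k : ℕ) : ℝ :=
  sVal A k * fSigma σ (k + 1) ^ (1 / p)

/-- membership in the class `GS_{p,σ}`: compact with `s_k(A) = O(f_σ(k)^{-1/p})` -/
def MemGS (p σ : ℝ) (A : H →L[ℂ] H) : Prop :=
  IsCompactOperator ⇑A ∧ ∃ C : ℝ, ∀ k, sWeight p σ A k ≤ C

/-- the quasi-norm of `GS_{p,σ}` -/
def GSnorm (p σ : ℝ) (A : H →L[ℂ] H) : ℝ := ⨆ k : ℕ, sWeight p σ A k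

/-- `G_{p,σ}(A) = limsup_k s_k(A) f_σ(k)^{1/p}` -/
def Gfun (p σ : ℝ) (A : H →L[ℂ] H) : ℝ := limsup (sWeight p σ A) atTop

def gfun (p σ : ℝ) (A : H →L[ℂ] H) : ℝ := liminf (sWeight p σ A) atTop

def eigPlus (A : H →L[ℂ] H) (k : ℕ) : ℝ :=
  ⨅ V : {V : Submodule ℂ H // Module.rank ℂ V ≤ (k : Cardinal)},
    ⨆ u : {u : H // u ∈ (V : Submodule ℂ H)ᗮ ∧ ‖u‖ = 1},
      (⟪A u.1, u.1⟫_ℂ).re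

def eigMinus (A : H →L[ℂ] H) (k : ℕ) : ℝ := eigPlus (-A) k

def GfunPlus (p σ : ℝ) (A : H →L[ℂ] H) : ℝ :=
  limsup (fun k => eigPlus A k * fSigma σ (k + 1) ^ (1 / p)) atTop

def gfunPlus (p σ : ℝ) (A : H →L[ℂ] H) : ℝ :=
  liminf (fun k => eigPlus A k * fSigma σ (k + 1) ^ (1 / p)) atTop

def GfunMinus (p σ : ℝ) (A : H →L[ℂ] H) : ℝ := GfunPlus p σ (-A)

def gfunMinus (p σ : ℝ) (A : H →L[ℂ] H) : ℝ := gfunPlus p σ (-A)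

/-- `N_{p,σ}[ρ]` (with the counting measure, this is `M_{p,σ}[v]`) -/
def Nfunc {α : Type*} [MeasurableSpace α] (p σ : ℝ) (μ : Measure α) (ρ : α → ℝ) : ℝ≥0∞ :=
  ⨆ (E : ℝ) (_ : 0 < E),
    ENNReal.ofReal (E * (Real.log (E⁻¹ + 2)) ^ (-σ)) * (μ {τ | E < ρ τ}) ^ (1 / p)

/-- `N°_{p,σ}[ρ]` -/
def NfuncLim {α : Type*} [MeasurableSpace α] (p σ : ℝ) (μ : Measure α) (ρ : α → ℝ) : ℝ≥0∞ :=
  limsup (fun E : ℝ =>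
    ENNReal.ofReal (E * (Real.log (E⁻¹ + 2)) ^ (-σ)) * (μ {τ | E < ρ τ}) ^ (1 / p))
    (nhdsWithin 0 (Set.Ioi 0))

/-- The class `fSigma` is regularly varying of index one. -/
theorem tendsto_fSigma_div {ι : Type*} {l : Filter ι} (σ : ℝ) {x y : ι → ℝ} {θ : ℝ} (hθ : 0 < θ)
    (hx : Tendsto x l atTop) (hy : Tendsto y l atTop)
    (hxy : Tendsto (fun n => x n / y n) l (nhds θ)) :
    Tendsto (fun n => fSigma σ (y n) / fSigma σ (x n)) l (nhds θ⁻¹) := by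
  set c := Real.exp (σ + 1)
  have hX : Tendsto (fun n => x n + c) l atTop := tendsto_atTop_add_const_right _ _ hx
  have hY : Tendsto (fun n => y n + c) l atTop := tendsto_atTop_add_const_right _ _ hy
  have hlY : Tendsto (fun n => Real.log (y n + c)) l atTop := Real.tendsto_log_atTop.comp hY
  have hcy : Tendsto (fun n => c / y n) l (nhds 0) := hy.const_div_atTop c
  have hXY : Tendsto (fun n => (x n + c) / (y n + c)) l (nhds θ) := by
    have h := (hxy.add hcy).div (hcy.const_add 1) (by norm_num)
    simp only [add_zero, div_one] at h
    refine h.congr' ?_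
    filter_upwards [hy.eventually_gt_atTop 0, hY.eventually_gt_atTop 0] with n h1 h2
    have := h2.ne'
    simp only [Pi.div_apply]
    field_simp
  have hlog : Tendsto (fun n => Real.log (x n + c) / Real.log (y n + c)) l (nhds 1) := by
    have h := ((hXY.log hθ.ne').div_atTop hlY).add_const 1
    rw [zero_add] at h
    refine h.congr' ?_
    filter_upwards [hX.eventually_gt_atTop 0, hY.eventually_gt_atTop 0,
      hlY.eventually_gt_atTop 0] with n h1 h2 h3
    rw [Real.log_div h1.ne' h2.ne']
    field_simp
    ring
  have h := (hxy.inv₀ hθ.ne').mul (hlog.rpow_const (p := σ) (Or.inl one_ne_zero))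
  rw [Real.one_rpow, mul_one] at h
  refine h.congr' ?_
  filter_upwards [hx.eventually_gt_atTop 0, hy.eventually_gt_atTop 0,
    hlY.eventually_gt_atTop 0, hX.eventually_gt_atTop 1] with n h1 h2 h3 h4
  have h5 : 0 < Real.log (x n + c) := Real.log_pos h4
  rw [Real.div_rpow h5.le h3.le]
  change _ = y n / Real.log (y n + c) ^ σ / (x n / Real.log (x n + c) ^ σ)
  have := (Real.rpow_pos_of_pos h3 σ).ne'
  have := (Real.rpow_pos_of_pos h5 σ).ne'
  field_simp

theorem fSigma_pos {σ t : ℝ} (hσ : 0 ≤ σ) (ht : 0 < t) : 0 < fSigma σ t := by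
  have : 1 < t + Real.exp (σ + 1) := by
    have := Real.one_le_exp (show 0 ≤ σ + 1 by linarith)
    linarith
  exact div_pos ht (Real.rpow_pos_of_pos (Real.log_pos this) σ)

theorem tendsto_fSigma_atTop (σ : ℝ) : Tendsto (fSigma σ) atTop atTop := by
  set c := Real.exp (σ + 1)
  have hX : Tendsto (fun t : ℝ => t + c) atTop atTop :=
    tendsto_atTop_add_const_right _ _ tendsto_id
  have h := (isLittleO_log_rpow_rpow_atTop σ one_pos).tendsto_div_nhds_zero.comp hX
  have hpos : ∀ᶠ t : ℝ in atTop, 0 < Real.log (t + c) ^ σ / (t + c) := by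
    filter_upwards [hX.eventually_gt_atTop 1] with t ht
    exact div_pos (Real.rpow_pos_of_pos (Real.log_pos ht) _) (by linarith)
  have h' : Tendsto (fun t : ℝ => Real.log (t + c) ^ σ / (t + c)) atTop
      (nhdsWithin 0 (Set.Ioi 0)) := by
    refine tendsto_nhdsWithin_iff.2 ⟨?_, hpos⟩
    simpa [Function.comp_def] using h
  have h2 := h'.inv_tendsto_nhdsGT_zero
  refine tendsto_atTop_mono' atTop ?_ (h2.atTop_div_const (show (0 : ℝ) < 2 by norm_num))
  filter_upwards [eventually_gt_atTop 0, eventually_ge_atTop c, hX.eventually_gt_atTop 1]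
    with t h0 h1 h3
  have := Real.rpow_pos_of_pos (Real.log_pos h3) σ
  simp only [Pi.inv_apply, inv_div, fSigma]
  rw [div_div, div_le_div_iff₀ (by positivity) this]
  nlinarith

/-- The weight `f_σ(k)^{1/p}`, with `k` counted from zero. -/
def fWeight (p σ : ℝ) (k : ℕ) : ℝ := fSigma σ (k + 1) ^ (1 / p)

theorem fWeight_pos {p σ : ℝ} (hσ : 0 ≤ σ) (k : ℕ) : 0 < fWeight p σ k :=
  Real.rpow_pos_of_pos (fSigma_pos hσ (by positivity)) _

theorem tendsto_fWeight_atTop {p : ℝ} (hp : 0 < p) (σ : ℝ) :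
    Tendsto (fWeight p σ) atTop atTop :=
  (tendsto_rpow_atTop (one_div_pos.2 hp)).comp <| (tendsto_fSigma_atTop σ).comp <|
    tendsto_atTop_add_const_right _ _ tendsto_natCast_atTop_atTop

theorem tendsto_fWeight_div {ι : Type*} {l : Filter ι} {p σ : ℝ} (hσ : 0 ≤ σ)
    {i k : ι → ℕ} {θ : ℝ} (hθ : 0 < θ) (hk : Tendsto k l atTop)
    (hik : Tendsto (fun n => (i n : ℝ) / k n) l (nhds θ)) :
    Tendsto (fun n => fWeight p σ (k n) / fWeight p σ (i n)) l (nhds (θ⁻¹ ^ (1 / p))) := by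
  have hk' : Tendsto (fun n => (k n : ℝ)) l atTop := tendsto_natCast_atTop_atTop.comp hk
  have hi' : Tendsto (fun n => (i n : ℝ)) l atTop := by
    refine (hik.pos_mul_atTop hθ hk').congr' ?_
    filter_upwards [hk'.eventually_gt_atTop 0] with n hn
    field_simp
  have hk1 : Tendsto (fun n => (k n : ℝ) + 1) l atTop := tendsto_atTop_add_const_right _ _ hk'
  have hi1 : Tendsto (fun n => (i n : ℝ) + 1) l atTop := tendsto_atTop_add_const_right _ _ hi'
  have hr : Tendsto (fun n => ((i n : ℝ) + 1) / (k n + 1)) l (nhds θ) := by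
    have hc : Tendsto (fun n => 1 / (k n : ℝ)) l (nhds 0) := hk'.const_div_atTop 1
    have h := (hik.add hc).div (hc.const_add 1) (by norm_num)
    simp only [add_zero, div_one] at h
    refine h.congr' ?_
    filter_upwards [hk'.eventually_gt_atTop 0] with n h1
    simp only [Pi.div_apply]
    field_simp
  refine ((tendsto_fSigma_div σ hθ hi1 hk1 hr).rpow_const
    (p := 1 / p) (Or.inl (inv_pos.2 hθ).ne')).congr fun n => ?_
  rw [Real.div_rpow (fSigma_pos hσ (by positivity)).le (fSigma_pos hσ (by positivity)).le]
  rfl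

/-- At the optimal splitting `θ : 1 - θ = x : y` the weighted bound is a power of `x + y`. -/
theorem split_value {p x y : ℝ} (hp : 0 < p) (hx : 0 < x) (hy : 0 < y) :
    (x / (x + y))⁻¹ ^ (1 / p) * x ^ ((p + 1) / p) + (y / (x + y))⁻¹ ^ (1 / p) * y ^ ((p + 1) / p)
      = (x + y) ^ ((p + 1) / p) := by
  have key : ∀ z : ℝ, 0 < z → z ^ ((p + 1) / p) = z * z ^ (1 / p) := fun z hz => by
    rw [show (p + 1) / p = 1 + 1 / p by field_simp, Real.rpow_add hz, Real.rpow_one]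
  have hxy : 0 < x + y := by positivity
  rw [key x hx, key y hy, key _ hxy, inv_div, inv_div, Real.div_rpow hxy.le hx.le,
    Real.div_rpow hxy.le hy.le]
  have := (Real.rpow_pos_of_pos hx (1 / p)).ne'
  have := (Real.rpow_pos_of_pos hy (1 / p)).ne'
  field_simp

section Sequences

variable {p σ : ℝ} {a b c : ℕ → ℝ}

/-- Asymptotic form of `c (i + j) ≤ a i + b j` for indices splitting in the proportion `x : y`. -/
theorem eventually_weighted_le {ι : Type*} {l : Filter ι} (hp : 0 < p) (hσ : 0 ≤ σ)
    (hsub : ∀ i j, c (i + j) ≤ a i + b j) {i j : ι → ℕ} {x y ε : ℝ}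
    (hx : 0 < x) (hy : 0 < y) (hε : 0 < ε) (hk : Tendsto (fun n => i n + j n) l atTop)
    (hik : Tendsto (fun n => (i n : ℝ) / (i n + j n : ℕ)) l (nhds (x / (x + y)))) :
    ∀ᶠ n in l, a (i n) * fWeight p σ (i n) ≤ x ^ ((p + 1) / p) →
      b (j n) * fWeight p σ (j n) ≤ y ^ ((p + 1) / p) →
      c (i n + j n) * fWeight p σ (i n + j n) ≤ (x + y) ^ ((p + 1) / p) + ε := by
  have hjk : Tendsto (fun n => (j n : ℝ) / (i n + j n : ℕ)) l (nhds (y / (x + y))) := by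
    have h := hik.const_sub 1
    rw [show 1 - x / (x + y) = y / (x + y) by field_simp; ring] at h
    refine h.congr' ?_
    filter_upwards [hk.eventually_gt_atTop 0] with n hn
    have : (0 : ℝ) < (i n + j n : ℕ) := by exact_mod_cast hn
    field_simp
    push_cast
    ring
  have hlim := ((tendsto_fWeight_div (p := p) hσ (by positivity) hk hik).mul_const
    (x ^ ((p + 1) / p))).add
    ((tendsto_fWeight_div (p := p) hσ (by positivity) hk hjk).mul_const (y ^ ((p + 1) / p)))
  rw [split_value hp hx hy] at hlim
  filter_upwards [hlim.eventually_lt_const (lt_add_of_pos_right _ hε)] with n hn h1 h2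
  have hwi := fWeight_pos (p := p) hσ (i n)
  have hwj := fWeight_pos (p := p) hσ (j n)
  have hwk := fWeight_pos (p := p) hσ (i n + j n)
  refine le_trans ?_ hn.le
  calc c (i n + j n) * fWeight p σ (i n + j n)
      ≤ (a (i n) + b (j n)) * fWeight p σ (i n + j n) := by gcongr; exact hsub _ _
    _ = fWeight p σ (i n + j n) / fWeight p σ (i n) * (a (i n) * fWeight p σ (i n))
        + fWeight p σ (i n + j n) / fWeight p σ (j n) * (b (j n) * fWeight p σ (j n)) := by
        field_simp
    _ ≤ _ := by gcongr

theorem rpow_le_add_of_forall {q C s t : ℝ} (hq : 0 < q)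
    (hs : 0 ≤ s) (ht : 0 ≤ t) (hC : 0 ≤ C)
    (h : ∀ x y ε, 0 < x → 0 < y → 0 < ε → s < x ^ q⁻¹ → t < y ^ q⁻¹ → C ≤ (x + y) ^ q⁻¹ + ε) :
    C ^ q ≤ s ^ q + t ^ q := by
  have hlim : Tendsto (fun δ : ℝ => (s + δ) ^ q + (t + δ) ^ q) (nhdsWithin 0 (Set.Ioi 0))
      (nhds (s ^ q + t ^ q)) := by
    have : Continuous fun δ : ℝ => (s + δ) ^ q + (t + δ) ^ q :=
      ((continuous_const.add continuous_id).rpow_const fun _ => Or.inr hq.le).add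
        ((continuous_const.add continuous_id).rpow_const fun _ => Or.inr hq.le)
    simpa using (this.tendsto 0).mono_left nhdsWithin_le_nhds
  refine ge_of_tendsto hlim ?_
  filter_upwards [self_mem_nhdsWithin] with δ hδ
  have hδ : 0 < δ := hδ
  have hx : 0 < (s + δ) ^ q := by positivity
  have hy : 0 < (t + δ) ^ q := by positivity
  have hle : C ≤ ((s + δ) ^ q + (t + δ) ^ q) ^ q⁻¹ := by
    refine le_of_forall_pos_le_add fun ε hε => h _ _ ε hx hy hε ?_ ?_
    · rw [Real.rpow_rpow_inv (by positivity) hq.ne']; linarith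
    · rw [Real.rpow_rpow_inv (by positivity) hq.ne']; linarith
  calc C ^ q ≤ (((s + δ) ^ q + (t + δ) ^ q) ^ q⁻¹) ^ q := by gcongr
    _ = _ := Real.rpow_inv_rpow (by positivity) hq.ne'

theorem limsup_nonneg_of_nonneg {u : ℕ → ℝ} (h0 : ∀ n, 0 ≤ u n) : 0 ≤ limsup u atTop := by
  rw [limsup_eq]
  exact Real.sInf_nonneg fun r hr => let ⟨n, hn⟩ := hr.exists; (h0 n).trans hn

theorem liminf_nonneg_of_nonneg {u : ℕ → ℝ} (h0 : ∀ n, 0 ≤ u n) : 0 ≤ liminf u atTop := by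
  rw [liminf_eq]
  exact Real.sSup_nonneg' ⟨0, Eventually.of_forall h0, le_rfl⟩

theorem limsup_rpow_le_add
    (hp : 0 < p) (hσ : 0 ≤ σ) (ha : ∀ k, 0 ≤ a k) (hb : ∀ k, 0 ≤ b k) (hc : ∀ k, 0 ≤ c k)
    (hsub : ∀ i j, c (i + j) ≤ a i + b j)
    (hA : ∃ C, ∀ k, a k * fWeight p σ k ≤ C) (hB : ∃ C, ∀ k, b k * fWeight p σ k ≤ C) :
    limsup (fun k => c k * fWeight p σ k) atTop ^ (p / (p + 1)) ≤
      limsup (fun k => a k * fWeight p σ k) atTop ^ (p / (p + 1)) +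
      limsup (fun k => b k * fWeight p σ k) atTop ^ (p / (p + 1)) := by
  have h0 : ∀ {u : ℕ → ℝ}, (∀ k, 0 ≤ u k) → ∀ k, 0 ≤ u k * fWeight p σ k := fun hu k =>
    mul_nonneg (hu k) (fWeight_pos hσ k).le
  refine rpow_le_add_of_forall (by positivity) (limsup_nonneg_of_nonneg (h0 ha))
    (limsup_nonneg_of_nonneg (h0 hb)) (limsup_nonneg_of_nonneg (h0 hc))
    fun x y ε hx hy hε h1 h2 => ?_
  rw [inv_div] at *
  have hθ : 0 < x / (x + y) := by positivity
  have hθ1 : x / (x + y) ≤ 1 := (div_le_one (by positivity)).2 (by linarith)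
  have hle : ∀ n : ℕ, ⌈x / (x + y) * n⌉₊ ≤ n := fun n => by
    rw [Nat.ceil_le]
    exact mul_le_of_le_one_left n.cast_nonneg hθ1
  have hadd : ∀ n : ℕ, ⌈x / (x + y) * n⌉₊ + (n - ⌈x / (x + y) * n⌉₊) = n := fun n =>
    Nat.add_sub_cancel' (hle n)
  have hceil : Tendsto (fun n : ℕ => (⌈x / (x + y) * n⌉₊ : ℝ) / n) atTop (nhds (x / (x + y))) :=
    (tendsto_nat_ceil_mul_div_atTop hθ.le).comp tendsto_natCast_atTop_atTop
  have hi : Tendsto (fun n : ℕ => ⌈x / (x + y) * n⌉₊) atTop atTop :=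
    tendsto_nat_ceil_atTop.comp (tendsto_natCast_atTop_atTop.const_mul_atTop hθ)
  have hj : Tendsto (fun n : ℕ => n - ⌈x / (x + y) * n⌉₊) atTop atTop := by
    rw [← tendsto_natCast_atTop_iff (R := ℝ)]
    have h := hceil.const_sub 1
    have hpos : 0 < 1 - x / (x + y) := by
      rw [show 1 - x / (x + y) = y / (x + y) by field_simp; ring]; positivity
    refine (h.pos_mul_atTop hpos tendsto_natCast_atTop_atTop).congr' ?_
    filter_upwards [eventually_gt_atTop 0] with n hn
    have : (n : ℝ) ≠ 0 := by positivity
    rw [Nat.cast_sub (hle n)]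
    field_simp
  have key := eventually_weighted_le (l := atTop) hp hσ hsub
    (i := fun n : ℕ => ⌈x / (x + y) * n⌉₊) (j := fun n => n - ⌈x / (x + y) * n⌉₊) hx hy hε
    (by simp only [hadd]; exact tendsto_id) (by simpa only [hadd] using hceil)
  simp only [hadd] at key
  refine limsup_le_of_le (isBoundedUnder_of ⟨0, h0 hc⟩).isCoboundedUnder_le ?_
  filter_upwards [key, hi.eventually (eventually_lt_of_limsup_lt h1 (isBoundedUnder_of hA)),
    hj.eventually (eventually_lt_of_limsup_lt h2 (isBoundedUnder_of hB))] with n hn ha' hb'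
  exact hn ha'.le hb'.le

theorem liminf_rpow_le_add
    (hp : 0 < p) (hσ : 0 ≤ σ) (ha : ∀ k, 0 ≤ a k) (hb : ∀ k, 0 ≤ b k) (hc : ∀ k, 0 ≤ c k)
    (hsub : ∀ i j, c (i + j) ≤ a i + b j)
    (hA : ∃ C, ∀ k, a k * fWeight p σ k ≤ C) (hB : ∃ C, ∀ k, b k * fWeight p σ k ≤ C) :
    liminf (fun k => c k * fWeight p σ k) atTop ^ (p / (p + 1)) ≤
      liminf (fun k => a k * fWeight p σ k) atTop ^ (p / (p + 1)) +
      limsup (fun k => b k * fWeight p σ k) atTop ^ (p / (p + 1)) := by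
  have h0 : ∀ {u : ℕ → ℝ}, (∀ k, 0 ≤ u k) → ∀ k, 0 ≤ u k * fWeight p σ k := fun hu k =>
    mul_nonneg (hu k) (fWeight_pos hσ k).le
  refine rpow_le_add_of_forall (by positivity) (liminf_nonneg_of_nonneg (h0 ha))
    (limsup_nonneg_of_nonneg (h0 hb)) (liminf_nonneg_of_nonneg (h0 hc))
    fun x y ε hx hy hε h1 h2 => ?_
  rw [inv_div] at *
  have hr : 0 < y / x := by positivity
  have hceil : Tendsto (fun n : ℕ => (⌈y / x * n⌉₊ : ℝ) / n) atTop (nhds (y / x)) :=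
    (tendsto_nat_ceil_mul_div_atTop hr.le).comp tendsto_natCast_atTop_atTop
  have hj : Tendsto (fun n : ℕ => ⌈y / x * n⌉₊) atTop atTop :=
    tendsto_nat_ceil_atTop.comp (tendsto_natCast_atTop_atTop.const_mul_atTop hr)
  have hk : Tendsto (fun n : ℕ => n + ⌈y / x * n⌉₊) atTop atTop :=
    tendsto_atTop_mono (fun n => Nat.le_add_right n _) tendsto_id
  have hratio : Tendsto (fun n : ℕ => (n : ℝ) / (n + ⌈y / x * n⌉₊ : ℕ)) atTop
      (nhds (x / (x + y))) := by
    have h := (hceil.const_add 1).inv₀ (by positivity)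
    rw [show (1 + y / x)⁻¹ = x / (x + y) by field_simp] at h
    refine h.congr' ?_
    filter_upwards [eventually_gt_atTop 0] with n hn
    have : (n : ℝ) ≠ 0 := by positivity
    push_cast
    field_simp
  have key := eventually_weighted_le (l := atTop) hp hσ hsub hx hy hε hk hratio
  have hfreq := frequently_lt_of_liminf_lt (isBoundedUnder_of hA).isCoboundedUnder_ge h1
  refine liminf_le_of_frequently_le (hk.frequently ?_) (isBoundedUnder_of ⟨0, h0 hc⟩)
  refine (hfreq.and_eventually (key.and (hj.eventually
    (eventually_lt_of_limsup_lt h2 (isBoundedUnder_of hB))))).mono ?_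
  rintro n ⟨ha', hn, hb'⟩
  exact hn ha'.le hb'.le

end Sequences

section SingularValues

theorem bddBelow_norm_sub_image (A : H →L[ℂ] H) (s : Set (H →L[ℂ] H)) :
    BddBelow ((fun F : H →L[ℂ] H => ‖A - F‖) '' s) :=
  ⟨0, by rintro _ ⟨F, -, rfl⟩; exact norm_nonneg _⟩

theorem nonempty_norm_sub_image (A : H →L[ℂ] H) (k : ℕ) :
    ((fun F : H →L[ℂ] H => ‖A - F‖) ''
      {F | Module.rank ℂ (LinearMap.range (F : H →ₗ[ℂ] H)) ≤ (k : Cardinal)}).Nonempty :=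
  ⟨_, 0, by simp, rfl⟩

theorem sVal_nonneg (A : H →L[ℂ] H) (k : ℕ) : 0 ≤ sVal A k :=
  Real.sInf_nonneg (by rintro _ ⟨F, -, rfl⟩; exact norm_nonneg _)

theorem exists_norm_sub_lt (A : H →L[ℂ] H) (k : ℕ) {r : ℝ} (hr : sVal A k < r) :
    ∃ F : H →L[ℂ] H, Module.rank ℂ (LinearMap.range (F : H →ₗ[ℂ] H)) ≤ (k : Cardinal) ∧
      ‖A - F‖ < r := by
  obtain ⟨_, ⟨F, hF, rfl⟩, h⟩ := exists_lt_of_csInf_lt (nonempty_norm_sub_image A k) hr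
  exact ⟨F, hF, h⟩

theorem sVal_le (A : H →L[ℂ] H) {k : ℕ} {F : H →L[ℂ] H}
    (hF : Module.rank ℂ (LinearMap.range (F : H →ₗ[ℂ] H)) ≤ (k : Cardinal)) :
    sVal A k ≤ ‖A - F‖ :=
  csInf_le (bddBelow_norm_sub_image A _) ⟨F, hF, rfl⟩

theorem sVal_add_le (A B : H →L[ℂ] H) (i j : ℕ) :
    sVal (A + B) (i + j) ≤ sVal A i + sVal B j := by
  refine le_of_forall_pos_le_add fun ε hε => ?_
  obtain ⟨F, hF, hF'⟩ := exists_norm_sub_lt A i (lt_add_of_pos_right _ (half_pos hε))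
  obtain ⟨K, hK, hK'⟩ := exists_norm_sub_lt B j (lt_add_of_pos_right _ (half_pos hε))
  have hrank : Module.rank ℂ (LinearMap.range ((F + K : H →L[ℂ] H) : H →ₗ[ℂ] H))
      ≤ ((i + j : ℕ) : Cardinal) := by
    rw [Nat.cast_add]
    exact (LinearMap.rank_add_le (F : H →ₗ[ℂ] H) (K : H →ₗ[ℂ] H)).trans (add_le_add hF hK)
  have h := (sVal_le (A + B) hrank).trans_eq (congrArg norm (add_sub_add_comm A B F K))
  linarith [norm_add_le (A - F) (B - K)]

theorem sVal_neg_le (A : H →L[ℂ] H) (k : ℕ) : sVal (-A) k ≤ sVal A k := by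
  refine le_csInf (nonempty_norm_sub_image A k) ?_
  rintro _ ⟨F, hF, rfl⟩
  have hF' : Module.rank ℂ (LinearMap.range ((-F : H →L[ℂ] H) : H →ₗ[ℂ] H)) ≤ (k : Cardinal) := by
    rw [ContinuousLinearMap.toLinearMap_neg, LinearMap.range_neg]
    exact hF
  refine (sVal_le _ hF').trans_eq ?_
  rw [← norm_neg]
  congr 1
  abel

theorem MemGS.neg {p σ : ℝ} {A : H →L[ℂ] H} (hσ : 0 ≤ σ) (h : MemGS p σ A) : MemGS p σ (-A) := by
  obtain ⟨hc, C, hC⟩ := h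
  refine ⟨hc.neg, C, fun k => le_trans ?_ (hC k)⟩
  exact mul_le_mul_of_nonneg_right (sVal_neg_le A k) (fWeight_pos hσ k).le

end SingularValues

section Eigenvalues

theorem abs_re_inner_le (A : H →L[ℂ] H) {u : H} (hu : ‖u‖ = 1) : |(⟪A u, u⟫_ℂ).re| ≤ ‖A‖ := by
  calc |(⟪A u, u⟫_ℂ).re| ≤ ‖⟪A u, u⟫_ℂ‖ := Complex.abs_re_le_norm _
    _ ≤ ‖A u‖ * ‖u‖ := norm_inner_le_norm _ _
    _ ≤ ‖A‖ := by simpa [hu] using A.le_opNorm u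

/-- The supremum of the quadratic form of `A` over the unit sphere of `Vᗮ`. -/
def supForm (A : H →L[ℂ] H) (V : Submodule ℂ H) : ℝ :=
  ⨆ u : {u : H // u ∈ Vᗮ ∧ ‖u‖ = 1}, (⟪A u.1, u.1⟫_ℂ).re

theorem bddAbove_form (A : H →L[ℂ] H) (V : Submodule ℂ H) :
    BddAbove (Set.range fun u : {u : H // u ∈ Vᗮ ∧ ‖u‖ = 1} => (⟪A u.1, u.1⟫_ℂ).re) :=
  ⟨‖A‖, by rintro _ ⟨u, rfl⟩; exact (abs_le.1 (abs_re_inner_le A u.2.2)).2⟩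

theorem le_supForm (A : H →L[ℂ] H) {V : Submodule ℂ H} {u : H} (hu : u ∈ Vᗮ) (h1 : ‖u‖ = 1) :
    (⟪A u, u⟫_ℂ).re ≤ supForm A V :=
  le_ciSup (bddAbove_form A V) ⟨u, hu, h1⟩

theorem neg_norm_le_supForm (A : H →L[ℂ] H) (V : Submodule ℂ H) : -‖A‖ ≤ supForm A V := by
  rcases isEmpty_or_nonempty {u : H // u ∈ Vᗮ ∧ ‖u‖ = 1} with h | ⟨⟨u, hu, h1⟩⟩
  · rw [supForm, Real.iSup_of_isEmpty]
    exact neg_nonpos.2 (norm_nonneg _)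
  · exact (abs_le.1 (abs_re_inner_le A h1)).1.trans (le_supForm A hu h1)

theorem eigPlus_le_supForm (A : H →L[ℂ] H) {V : Submodule ℂ H} {k : ℕ}
    (hV : Module.rank ℂ V ≤ (k : Cardinal)) : eigPlus A k ≤ supForm A V :=
  ciInf_le (f := fun V : {V : Submodule ℂ H // Module.rank ℂ V ≤ (k : Cardinal)} =>
    supForm A V.1) ⟨-‖A‖, by rintro _ ⟨V, rfl⟩; exact neg_norm_le_supForm A V.1⟩ ⟨V, hV⟩

theorem nonempty_rank_le (k : ℕ) :
    Nonempty {V : Submodule ℂ H // Module.rank ℂ V ≤ (k : Cardinal)} :=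
  ⟨⟨⊥, by simp⟩⟩

theorem exists_supForm_lt (A : H →L[ℂ] H) (k : ℕ) {r : ℝ} (hr : eigPlus A k < r) :
    ∃ V : Submodule ℂ H, Module.rank ℂ V ≤ (k : Cardinal) ∧ supForm A V < r := by
  have := nonempty_rank_le (H := H) k
  obtain ⟨V, hV⟩ := exists_lt_of_ciInf_lt hr
  exact ⟨V.1, V.2, hV⟩

theorem eigPlus_le_sVal [CompleteSpace H] (A : H →L[ℂ] H) (k : ℕ) : eigPlus A k ≤ sVal A k := by
  refine le_csInf (nonempty_norm_sub_image A k) ?_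
  rintro _ ⟨F, hF, rfl⟩
  have hker : IsClosed ((LinearMap.ker (F : H →ₗ[ℂ] H) : Submodule ℂ H) : Set H) :=
    ContinuousLinearMap.isClosed_ker F
  have hoo : (LinearMap.ker (F : H →ₗ[ℂ] H))ᗮᗮ = LinearMap.ker (F : H →ₗ[ℂ] H) := by
    rw [Submodule.orthogonal_orthogonal_eq_closure]
    exact hker.submodule_topologicalClosure_eq
  have hrank : Module.rank ℂ ((LinearMap.ker (F : H →ₗ[ℂ] H))ᗮ : Submodule ℂ H)
      ≤ (k : Cardinal) := by
    refine le_trans ?_ hF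
    refine LinearMap.rank_le_of_injective
      ((F : H →ₗ[ℂ] H).rangeRestrict.comp (LinearMap.ker (F : H →ₗ[ℂ] H))ᗮ.subtype) ?_
    rw [← LinearMap.ker_eq_bot, LinearMap.ker_eq_bot']
    rintro ⟨u, hu⟩ h
    have hFu : F u = 0 := congrArg Subtype.val h
    have : u ∈ LinearMap.ker (F : H →ₗ[ℂ] H) := hFu
    exact Subtype.ext (inner_self_eq_zero.1 (hu u this))
  refine (eigPlus_le_supForm A hrank).trans (Real.iSup_le ?_ (norm_nonneg _))
  rintro ⟨u, hu, h1⟩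
  rw [hoo] at hu
  have hFu : F u = 0 := hu
  have := (abs_le.1 (abs_re_inner_le (A - F) h1)).2
  rwa [sub_apply, hFu, sub_zero] at this

/-- The quadratic form of a compact operator on an infinite-dimensional space is not bounded away
from zero from above on the orthogonal complement of a finite-dimensional subspace. -/
theorem supForm_nonneg_of_isCompactOperator [CompleteSpace H] {A : H →L[ℂ] H}
    (hA : IsCompactOperator A)
    (hH : ¬ FiniteDimensional ℂ H) (V : Submodule ℂ H) [FiniteDimensional ℂ V] :
    0 ≤ supForm A V := by
  by_contra! hneg
  set s := -supForm A V with hs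
  have hspos : 0 < s := by linarith
  have hbound : ∀ u : Vᗮ, s * ‖u‖ ≤ ‖A u‖ := by
    intro u
    rcases eq_or_ne u 0 with rfl | hu
    · simp
    have hu0 : ‖(u : H)‖ ≠ 0 := by simpa using hu
    set v : H := ((‖(u : H)‖⁻¹ : ℝ) : ℂ) • (u : H) with hv
    have hv1 : ‖v‖ = 1 := by
      rw [hv, norm_smul, Complex.norm_real, norm_inv, norm_norm, inv_mul_cancel₀ hu0]
    have hvV : v ∈ Vᗮ := Vᗮ.smul_mem _ u.2
    have h1 := le_supForm A hvV hv1
    have h2 : -(⟪A v, v⟫_ℂ).re ≤ ‖A v‖ := by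
      have := (neg_le_abs _).trans ((Complex.abs_re_le_norm _).trans
        (norm_inner_le_norm (𝕜 := ℂ) (A v) v))
      simpa [hv1] using this
    have h3 : ‖A v‖ = ‖(u : H)‖⁻¹ * ‖A u‖ := by
      rw [hv, map_smul, norm_smul, Complex.norm_real, norm_inv, norm_norm]
    have h4 : s ≤ ‖(u : H)‖⁻¹ * ‖A u‖ := by linarith
    have h5 : 0 < ‖(u : H)‖ := lt_of_le_of_ne (norm_nonneg _) hu0.symm
    rw [inv_mul_eq_div, le_div_iff₀ h5] at h4
    exact h4
  set T : Vᗮ →L[ℂ] H := A ∘L Vᗮ.subtypeL with hT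
  have hTc : IsCompactOperator T := hA.comp_clm Vᗮ.subtypeL
  have hanti : AntilipschitzWith (Real.toNNReal s)⁻¹ T := by
    refine AddMonoidHomClass.antilipschitz_of_bound T fun u => ?_
    rw [NNReal.coe_inv, Real.coe_toNNReal _ hspos.le, inv_mul_eq_div, le_div_iff₀ hspos, mul_comm]
    exact hbound u
  have hfin : FiniteDimensional ℂ Vᗮ := by
    refine FiniteDimensional.of_isCompact_closedBall ℂ one_pos (c := 0) ?_
    have hK := hTc.isCompact_closure_image_closedBall 1
    have hemb := hanti.isClosedEmbedding T.uniformContinuous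
    exact (hemb.isCompact_preimage hK).of_isClosed_subset Metric.isClosed_closedBall
      fun x hx => subset_closure ⟨x, hx, rfl⟩
  refine hH ?_
  have : FiniteDimensional ℂ (V ⊔ Vᗮ : Submodule ℂ H) := Submodule.finiteDimensional_sup _ _
  rw [Submodule.sup_orthogonal_of_hasOrthogonalProjection] at this
  exact Module.finite_def.2 (Submodule.fg_top _ |>.1 (Module.finite_def.1 this))

theorem finiteDimensional_of_rank_le {V : Submodule ℂ H} {k : ℕ}
    (hV : Module.rank ℂ V ≤ (k : Cardinal)) : FiniteDimensional ℂ V :=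
  Module.rank_lt_aleph0_iff.1 (hV.trans_lt (Cardinal.natCast_lt_aleph0))

theorem eigPlus_nonneg [CompleteSpace H] {A : H →L[ℂ] H} (hA : IsCompactOperator A)
    (hH : ¬ FiniteDimensional ℂ H) (k : ℕ) : 0 ≤ eigPlus A k :=
  Real.iInf_nonneg fun V =>
    have := finiteDimensional_of_rank_le V.2
    supForm_nonneg_of_isCompactOperator hA hH V.1

theorem eigPlus_add_le [CompleteSpace H] {A B : H →L[ℂ] H} (hA : IsCompactOperator A)
    (hB : IsCompactOperator B) (hH : ¬ FiniteDimensional ℂ H) (i j : ℕ) :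
    eigPlus (A + B) (i + j) ≤ eigPlus A i + eigPlus B j := by
  refine le_of_forall_pos_le_add fun ε hε => ?_
  obtain ⟨V, hV, hV'⟩ := exists_supForm_lt A i (lt_add_of_pos_right _ (half_pos hε))
  obtain ⟨W, hW, hW'⟩ := exists_supForm_lt B j (lt_add_of_pos_right _ (half_pos hε))
  have := finiteDimensional_of_rank_le hV
  have := finiteDimensional_of_rank_le hW
  have hrank : Module.rank ℂ (V ⊔ W : Submodule ℂ H) ≤ ((i + j : ℕ) : Cardinal) := by
    rw [Nat.cast_add]
    exact (Submodule.rank_add_le_rank_add_rank V W).trans (add_le_add hV hW)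
  have hle : supForm (A + B) (V ⊔ W) ≤ supForm A V + supForm B W := by
    refine Real.iSup_le ?_ (add_nonneg (supForm_nonneg_of_isCompactOperator hA hH V)
      (supForm_nonneg_of_isCompactOperator hB hH W))
    rintro ⟨u, hu, h1⟩
    rw [← Submodule.inf_orthogonal] at hu
    rw [add_apply, inner_add_left, Complex.add_re]
    exact add_le_add (le_supForm A hu.1 h1) (le_supForm B hu.2 h1)
  linarith [eigPlus_le_supForm (A + B) hrank]

theorem exists_eigPlus_eventually_eq [FiniteDimensional ℂ H] (A : H →L[ℂ] H) :
    ∃ d ≤ 0, ∀ᶠ k in atTop, eigPlus A k = d := by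
  refine ⟨⨅ V : Submodule ℂ H, supForm A V, ?_, ?_⟩
  · refine (ciInf_le ⟨-‖A‖, by rintro _ ⟨V, rfl⟩; exact neg_norm_le_supForm A V⟩
      (⊤ : Submodule ℂ H)).trans (Real.iSup_le ?_ le_rfl)
    rintro ⟨u, hu, h1⟩
    rw [Submodule.top_orthogonal_eq_bot, Submodule.mem_bot] at hu
    simp [hu] at h1
  · filter_upwards [eventually_ge_atTop (Module.finrank ℂ H)] with k hk
    have hr : ∀ V : Submodule ℂ H, Module.rank ℂ V ≤ (k : Cardinal) := fun V => by
      rw [← Module.finrank_eq_rank]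
      exact_mod_cast V.finrank_le.trans hk
    exact (Equiv.subtypeUnivEquiv hr).iInf_congr fun _ => rfl

theorem limsup_eq_zero_of_tendsto_atBot {u : ℕ → ℝ} (h : Tendsto u atTop atBot) :
    limsup u atTop = 0 := by
  have : {a : ℝ | ∀ᶠ n in atTop, u n ≤ a} = Set.univ :=
    Set.eq_univ_of_forall fun a => h.eventually_le_atBot a
  rw [limsup_eq, this, Real.sInf_univ]

theorem liminf_eq_zero_of_tendsto_atBot {u : ℕ → ℝ} (h : Tendsto u atTop atBot) :
    liminf u atTop = 0 := by
  have : {a : ℝ | ∀ᶠ n in atTop, a ≤ u n} = ∅ :=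
    Set.eq_empty_of_forall_notMem fun a ha =>
      let ⟨_, h1, h2⟩ := (ha.and (h.eventually_lt_atBot a)).exists
      h1.not_gt h2
  rw [liminf_eq, this, Real.sSup_empty]

theorem GfunPlus_gfunPlus_eq_zero [FiniteDimensional ℂ H] {p : ℝ} (hp : 0 < p) (σ : ℝ)
    (A : H →L[ℂ] H) : GfunPlus p σ A = 0 ∧ gfunPlus p σ A = 0 := by
  obtain ⟨d, hd, hA⟩ := exists_eigPlus_eventually_eq A
  have heq : (fun k : ℕ => eigPlus A k * fSigma σ (k + 1) ^ (1 / p)) =ᶠ[atTop]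
      fun k => d * fWeight p σ k := by
    filter_upwards [hA] with k hk
    rw [hk, fWeight]
  rw [GfunPlus, gfunPlus, limsup_congr heq, liminf_congr heq]
  rcases hd.eq_or_lt with rfl | hd
  · simp
  · have := (tendsto_fWeight_atTop hp σ).const_mul_atTop_of_neg hd
    exact ⟨limsup_eq_zero_of_tendsto_atBot this, liminf_eq_zero_of_tendsto_atBot this⟩

theorem GfunPlus_gfunPlus_rpow_le_add [CompleteSpace H] {p σ : ℝ} (hp : 0 < p) (hσ : 0 ≤ σ)
    {A B : H →L[ℂ] H} (hA : MemGS p σ A) (hB : MemGS p σ B) :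
    GfunPlus p σ (A + B) ^ (p / (p + 1)) ≤
        GfunPlus p σ A ^ (p / (p + 1)) + GfunPlus p σ B ^ (p / (p + 1)) ∧
      gfunPlus p σ (A + B) ^ (p / (p + 1)) ≤
        gfunPlus p σ A ^ (p / (p + 1)) + GfunPlus p σ B ^ (p / (p + 1)) := by
  by_cases hH : FiniteDimensional ℂ H
  · have hq : p / (p + 1) ≠ 0 := by positivity
    simp [GfunPlus_gfunPlus_eq_zero hp, Real.zero_rpow hq]
  have hbdd : ∀ {T : H →L[ℂ] H}, MemGS p σ T → ∃ C, ∀ k, eigPlus T k * fWeight p σ k ≤ C :=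
    fun {T} ⟨_, C, hC⟩ => ⟨C, fun k => le_trans
      (mul_le_mul_of_nonneg_right (eigPlus_le_sVal T k) (fWeight_pos hσ k).le) (hC k)⟩
  have h0 := fun k => eigPlus_nonneg hA.1 hH k
  have h1 := fun k => eigPlus_nonneg hB.1 hH k
  have hAB : IsCompactOperator ⇑(A + B) := hA.1.add hB.1
  have h2 := fun k => eigPlus_nonneg hAB hH k
  exact ⟨limsup_rpow_le_add hp hσ h0 h1 h2 (eigPlus_add_le hA.1 hB.1 hH) (hbdd hA) (hbdd hB),
    liminf_rpow_le_add hp hσ h0 h1 h2 (eigPlus_add_le hA.1 hB.1 hH) (hbdd hA) (hbdd hB)⟩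

end Eigenvalues

/-- **Proposition.** Subadditivity of the asymptotic functionals `G_{p,σ}`, `g_{p,σ}` and,
for self-adjoint operators, of `G^{(±)}_{p,σ}`, `g^{(±)}_{p,σ}`. -/
theorem Gfun_gfun_subadditive {H : Type*} [NormedAddCommGroup H] [InnerProductSpace ℂ H]
    [CompleteSpace H]
    (p σ : ℝ) (hp : 0 < p) (hσ : 0 ≤ σ)
    (A₁ A₂ : H →L[ℂ] H) (h₁ : MemGS p σ A₁) (h₂ : MemGS p σ A₂) :
    (Gfun p σ (A₁ + A₂) ^ (p / (p + 1)) ≤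
        Gfun p σ A₁ ^ (p / (p + 1)) + Gfun p σ A₂ ^ (p / (p + 1))) ∧
    (gfun p σ (A₁ + A₂) ^ (p / (p + 1)) ≤
        gfun p σ A₁ ^ (p / (p + 1)) + Gfun p σ A₂ ^ (p / (p + 1))) ∧
    (IsSelfAdjoint A₁ → IsSelfAdjoint A₂ →
      (GfunPlus p σ (A₁ + A₂) ^ (p / (p + 1)) ≤
          GfunPlus p σ A₁ ^ (p / (p + 1)) + GfunPlus p σ A₂ ^ (p / (p + 1))) ∧
      (gfunPlus p σ (A₁ + A₂) ^ (p / (p + 1)) ≤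
          gfunPlus p σ A₁ ^ (p / (p + 1)) + GfunPlus p σ A₂ ^ (p / (p + 1))) ∧
      (GfunMinus p σ (A₁ + A₂) ^ (p / (p + 1)) ≤
          GfunMinus p σ A₁ ^ (p / (p + 1)) + GfunMinus p σ A₂ ^ (p / (p + 1))) ∧
      (gfunMinus p σ (A₁ + A₂) ^ (p / (p + 1)) ≤
          gfunMinus p σ A₁ ^ (p / (p + 1)) + GfunMinus p σ A₂ ^ (p / (p + 1)))) := by
  refine ⟨?_, ?_, fun _ _ => ?_⟩
  · exact limsup_rpow_le_add hp hσ (sVal_nonneg A₁) (sVal_nonneg A₂) (sVal_nonneg _)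
      (sVal_add_le A₁ A₂) h₁.2 h₂.2
  · exact liminf_rpow_le_add hp hσ (sVal_nonneg A₁) (sVal_nonneg A₂) (sVal_nonneg _)
      (sVal_add_le A₁ A₂) h₁.2 h₂.2
  · have hplus := GfunPlus_gfunPlus_rpow_le_add hp hσ h₁ h₂
    have hminus := GfunPlus_gfunPlus_rpow_le_add hp hσ (h₁.neg hσ) (h₂.neg hσ)
    rw [← neg_add] at hminus
    exact ⟨hplus.1, hplus.2, hminus.1, hminus.2⟩

end
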